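/- There exists a constant c > 0 such that for every n ≥ 1, 𝔠_P(n) ≤ 𝔠(n) + c·n^{4/3}, where 𝔠_P(n) is the maximal reset threshold over all n-state synchronizing strongly connected partial DFAs and 𝔠(n) is the maximal reset threshold over all n-state synchronizing complete DFAs. -/

import Mathlib

open scoped Classical

section Defs

variable {Q A : Type*}

/-- Action of a word in a partial DFA with transition function `δ`
(`none` means the undefined value ⊥). -/
def stepWord (δ : Q → A → Option Q) : Q → List A → Option Q
  | q, [] => some q
  | q, a :: w => (δ q a).bind (fun p => stepWord δ p w)

/-- The image `δ(S, w)` of a set of states under the action of a word. -/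
def img (δ : Q → A → Option Q) (S : Set Q) (w : List A) : Set Q :=
  {p | ∃ q ∈ S, stepWord δ q w = some p}

/-- The inseparability equivalence `p ≡ q`. -/
def Insep (δ : Q → A → Option Q) (p q : Q) : Prop :=
  ∀ u : List A, (stepWord δ p u).isSome ↔ (stepWord δ q u).isSome

/-- `κ(S)`: the number of inseparability classes intersecting `S`. -/
noncomputable def kappa (δ : Q → A → Option Q) (S : Set Q) : ℕ :=
  {C : Set Q | ∃ p ∈ S, C = {q | Insep δ p q}}.ncard

def StronglyConnected (δ : Q → A → Option Q) : Prop :=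
  ∀ p q : Q, ∃ w : List A, stepWord δ p w = some q

/-- The transition function of the fixing automaton `A^F`. -/
def fixDelta (δ : Q → A → Option Q) (q : Q) (a : A) : Q := (δ q a).getD q

/-- Action of a word in a complete DFA. -/
def stepWordC (δc : Q → A → Q) (q : Q) (w : List A) : Q := w.foldl δc q

/-- The image of a set of states under the action of a word in a complete DFA. -/
def imgC (δc : Q → A → Q) (S : Set Q) (w : List A) : Set Q :=
  (fun q => stepWordC δc q w) '' S

end Defs

section WordAction

variable {Q A : Type*}

theorem stepWord_append (δ : Q → A → Option Q) (q : Q) (u v : List A) :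
    stepWord δ q (u ++ v) = (stepWord δ q u).bind fun p => stepWord δ p v := by
  induction u generalizing q with
  | nil => rfl
  | cons a u ih =>
    simp only [List.cons_append, stepWord]
    cases δ q a with
    | none => rfl
    | some p => simpa using ih p

theorem stepWordC_append (δc : Q → A → Q) (q : Q) (u v : List A) :
    stepWordC δc q (u ++ v) = stepWordC δc (stepWordC δc q u) v := by
  simp [stepWordC]

end WordAction

section LinearAction

open Module

variable {A V : Type*} [AddCommGroup V] [Module ℚ V]

/-- The action of a word on a vector, the last letter acting first. -/
def linAct (T : A → V →ₗ[ℚ] V) (w : List A) (v : V) : V := w.foldr (fun a x => T a x) v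

/-- The span of the images of `v` under words of length at most `i`. -/
def wordSpan (T : A → V →ₗ[ℚ] V) (v : V) (i : ℕ) : Submodule ℚ V :=
  Submodule.span ℚ {x | ∃ w : List A, w.length ≤ i ∧ linAct T w v = x}

theorem linAct_mem_wordSpan (T : A → V →ₗ[ℚ] V) (v : V) {i : ℕ} {w : List A}
    (hw : w.length ≤ i) : linAct T w v ∈ wordSpan T v i :=
  Submodule.subset_span ⟨w, hw, rfl⟩

theorem wordSpan_mono (T : A → V →ₗ[ℚ] V) (v : V) : Monotone (wordSpan T v) := by
  intro i j hij
  apply Submodule.span_mono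
  rintro x ⟨w, hw, rfl⟩
  exact ⟨w, hw.trans hij, rfl⟩

theorem map_wordSpan_le (T : A → V →ₗ[ℚ] V) (v : V) (i : ℕ) (a : A) :
    (wordSpan T v i).map (T a) ≤ wordSpan T v (i + 1) := by
  rw [wordSpan, Submodule.map_span, Submodule.span_le]
  rintro _ ⟨_, ⟨w, hw, rfl⟩, rfl⟩
  exact linAct_mem_wordSpan T v (w := a :: w) (by simpa using hw)

theorem linAct_mem_of_wordSpan_eq (T : A → V →ₗ[ℚ] V) (v : V) {i : ℕ}
    (h : wordSpan T v i = wordSpan T v (i + 1)) (w : List A) :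
    linAct T w v ∈ wordSpan T v i := by
  induction w with
  | nil => exact linAct_mem_wordSpan T v (by simp)
  | cons a w ih =>
    rw [h]
    exact map_wordSpan_le T v i a ⟨_, ih, rfl⟩

theorem lt_finrank_wordSpan [FiniteDimensional ℚ V] (T : A → V →ₗ[ℚ] V) {v : V} (hv : v ≠ 0)
    (i : ℕ) (h : ∀ j < i, wordSpan T v j ≠ wordSpan T v (j + 1)) :
    i < finrank ℚ (wordSpan T v i) := by
  induction i with
  | zero =>
    rw [finrank_pos_iff_exists_ne_zero]
    exact ⟨⟨v, linAct_mem_wordSpan T v (w := []) (by simp)⟩,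
      fun h => hv (congrArg Subtype.val h)⟩
  | succ i ih =>
    have h1 := ih fun j hj => h j (by omega)
    have h2 := Submodule.finrank_lt_finrank_of_lt
      (lt_of_le_of_ne (wordSpan_mono T v (Nat.le_succ i)) (h i (by omega)))
    simp only [Nat.succ_eq_add_one] at h2
    omega

/-- If some word moves `v` out of the subspace `W`, then so does a word of length at most
`dim W`. -/
theorem exists_short_linAct_notMem [FiniteDimensional ℚ V] (T : A → V →ₗ[ℚ] V) (v : V)
    (W : Submodule ℚ V) (h : ∃ w, linAct T w v ∉ W) :
    ∃ w : List A, w.length ≤ finrank ℚ W ∧ linAct T w v ∉ W := by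
  by_contra! hcon
  obtain ⟨w, hw⟩ := h
  have hv : v ≠ 0 := by
    rintro rfl
    apply hw
    have : linAct T w 0 = 0 := by
      clear hw
      induction w with
      | nil => rfl
      | cons a w ih =>
        change T a (linAct T w 0) = 0
        rw [ih, map_zero]
    rw [this]
    exact W.zero_mem
  have hle : wordSpan T v (finrank ℚ W) ≤ W := by
    rw [wordSpan, Submodule.span_le]
    rintro _ ⟨u, hu, rfl⟩
    exact hcon u hu
  by_cases hst : ∀ j < finrank ℚ W, wordSpan T v j ≠ wordSpan T v (j + 1)
  · have h1 := lt_finrank_wordSpan T hv _ hst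
    have h2 := Submodule.finrank_mono hle
    omega
  · push Not at hst
    obtain ⟨j, hj, hjeq⟩ := hst
    exact hw (hle (wordSpan_mono T v hj.le (linAct_mem_of_wordSpan_eq T v hjeq w)))

end LinearAction

section PartialDFA

variable {Q A : Type*}

/-- The action of a letter of a partial DFA on rational functions on the states. -/
def pullback (δ : Q → A → Option Q) (a : A) : (Q → ℚ) →ₗ[ℚ] (Q → ℚ) where
  toFun f q := (δ q a).elim 0 f
  map_add' f g := by
    funext q
    cases h : δ q a <;> simp [h]
  map_smul' c f := by
    funext q
    cases h : δ q a <;> simp [h]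

theorem linAct_pullback (δ : Q → A → Option Q) (w : List A) (f : Q → ℚ) (q : Q) :
    linAct (pullback δ) w f q = (stepWord δ q w).elim 0 f := by
  induction w generalizing q with
  | nil => rfl
  | cons a w ih =>
    change (δ q a).elim 0 (linAct (pullback δ) w f) = _
    simp only [stepWord]
    cases δ q a with
    | none => rfl
    | some p => simpa using ih p

/-- A set of states reachable from `q` is reachable by a word of length at most the number of
states. -/
theorem exists_short_stepWord [Fintype Q] (δ : Q → A → Option Q) (q : Q) (F : Set Q)
    (h : ∃ w, ∃ p ∈ F, stepWord δ q w = some p) :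
    ∃ w : List A, w.length ≤ Fintype.card Q ∧ ∃ p ∈ F, stepWord δ q w = some p := by
  obtain ⟨w, p, hp, hw⟩ := h
  obtain ⟨u, hu, hu'⟩ := exists_short_linAct_notMem (pullback δ) (F.indicator 1)
    (LinearMap.ker (LinearMap.proj (R := ℚ) (φ := fun _ : Q => ℚ) q))
    ⟨w, by simp [linAct_pullback, hw, hp]⟩
  refine ⟨u, hu.trans ((Submodule.finrank_le _).trans_eq (by simp)), ?_⟩
  simp only [LinearMap.mem_ker, LinearMap.proj_apply, linAct_pullback] at hu'
  cases h : stepWord δ q u with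
  | none => simp [h] at hu'
  | some r =>
    refine ⟨r, ?_, rfl⟩
    by_contra hr
    simp [h, hr] at hu'

end PartialDFA

section CompleteDFA

variable {Q A : Type*}

theorem imgC_append (δc : Q → A → Q) (S : Set Q) (u v : List A) :
    imgC δc S (u ++ v) = imgC δc (imgC δc S u) v := by
  simp [imgC, Set.image_image, stepWordC_append]

/-- If any two states can be merged by a word of length at most `N`, then any nonempty set of
states can be reduced to a single state by repeated merging. -/
theorem exists_reset_of_merge [Finite Q] (δc : Q → A → Q) (N : ℕ)
    (h : ∀ p q, ∃ w : List A, w.length ≤ N ∧ stepWordC δc p w = stepWordC δc q w)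
    (k : ℕ) (S : Set Q) (hS : S.Nonempty) (hk : S.ncard ≤ k + 1) :
    ∃ w : List A, w.length ≤ k * N ∧ (imgC δc S w).ncard = 1 := by
  induction k generalizing S with
  | zero =>
    refine ⟨[], by simp, ?_⟩
    have := (Set.ncard_pos (Set.toFinite S)).2 hS
    have h1 : imgC δc S [] = S := by simp [imgC, stepWordC]
    rw [h1]
    omega
  | succ k ih =>
    have hpos := (Set.ncard_pos (Set.toFinite S)).2 hS
    rcases Nat.lt_or_ge 1 S.ncard with h1 | h1
    · obtain ⟨p, q, hp, hq, hpq⟩ := (Set.one_lt_ncard_iff (Set.toFinite S)).1 h1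
      obtain ⟨u, hu, hpu⟩ := h p q
      have hlt : (imgC δc S u).ncard < S.ncard := by
        refine lt_of_le_of_ne (Set.ncard_image_le (Set.toFinite S)) fun heq => hpq ?_
        exact Set.injOn_of_ncard_image_eq heq (Set.toFinite S) hp hq hpu
      obtain ⟨v, hv, hv'⟩ := ih (imgC δc S u) (hS.image _) (by omega)
      refine ⟨u ++ v, ?_, by rwa [imgC_append]⟩
      rw [List.length_append, Nat.succ_mul]
      omega
    · refine ⟨[], by simp, ?_⟩
      have h2 : imgC δc S [] = S := by simp [imgC, stepWordC]
      rw [h2]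
      omega

theorem stepWord_pair (δc : Q → A → Q) (p q : Q) (w : List A) :
    stepWord (fun (x : Q × Q) a => some (δc x.1 a, δc x.2 a)) (p, q) w =
      some (stepWordC δc p w, stepWordC δc q w) := by
  induction w generalizing p q with
  | nil => rfl
  | cons a w ih => simpa [stepWord, stepWordC] using ih (δc p a) (δc q a)

/-- A cubic upper bound on the reset threshold of complete DFAs. -/
theorem exists_reset_le_cube [Fintype Q] [Nonempty Q] (δc : Q → A → Q)
    (h : ∃ w, (imgC δc Set.univ w).ncard = 1) :
    ∃ w : List A, w.length ≤ Fintype.card Q ^ 3 ∧ (imgC δc Set.univ w).ncard = 1 := by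
  obtain ⟨w, hw⟩ := h
  obtain ⟨x, hx⟩ := Set.ncard_eq_one.1 hw
  have hx' : ∀ p, stepWordC δc p w = x := fun p => by
    have : stepWordC δc p w ∈ imgC δc Set.univ w := ⟨p, trivial, rfl⟩
    simpa [hx] using this
  obtain ⟨u, hu, hu'⟩ := exists_reset_of_merge δc (Fintype.card Q ^ 2) (fun p q => by
    obtain ⟨v, hv, y, hy, hvy⟩ := exists_short_stepWord
      (fun (x : Q × Q) a => some (δc x.1 a, δc x.2 a)) (p, q) {y | y.1 = y.2}
      ⟨w, (x, x), rfl, by rw [stepWord_pair, hx', hx']⟩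
    rw [stepWord_pair, Option.some_inj] at hvy
    refine ⟨v, hv.trans_eq (by rw [Fintype.card_prod, sq]), ?_⟩
    subst hvy
    exact hy) (Fintype.card Q) Set.univ Set.univ_nonempty
    (by rw [Set.ncard_univ, Nat.card_eq_fintype_card]; omega)
  exact ⟨u, hu.trans_eq (by ring), hu'⟩

/-- If the rank of every word of rank at least two can be decreased, then there is a reset
word. -/
theorem exists_reset_of_rank_decrease [Finite Q] [Nonempty Q] (δc : Q → A → Q)
    (h : ∀ w, 1 < (imgC δc Set.univ w).ncard →
      ∃ v, (imgC δc Set.univ v).ncard < (imgC δc Set.univ w).ncard) :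
    ∃ w, (imgC δc Set.univ w).ncard = 1 := by
  obtain ⟨w, hw⟩ : ∃ w, ∀ v, (imgC δc Set.univ w).ncard ≤ (imgC δc Set.univ v).ncard :=
    ⟨_, fun v => Function.argmin_le (fun w => (imgC δc Set.univ w).ncard) v⟩
  refine ⟨w, ?_⟩
  have hpos : 0 < (imgC δc Set.univ w).ncard :=
    (Set.ncard_pos (Set.toFinite _)).2 (Set.univ_nonempty.image _)
  by_contra hne
  obtain ⟨v, hv⟩ := h w (by omega)
  exact absurd (hw v) (by omega)

end CompleteDFA

section Inseparability

variable {Q A : Type*}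

/-- Inseparability as a setoid. -/
def insepSetoid (δ : Q → A → Option Q) : Setoid Q where
  r := Insep δ
  iseqv := ⟨fun _ _ => Iff.rfl, fun h u => (h u).symm, fun h h' u => (h u).trans (h' u)⟩

/-- The inseparability class of a state. -/
def insepClass (δ : Q → A → Option Q) (q : Q) : Quotient (insepSetoid δ) :=
  Quotient.mk (insepSetoid δ) q

theorem insepClass_eq_iff {δ : Q → A → Option Q} {p q : Q} :
    insepClass δ p = insepClass δ q ↔ Insep δ p q :=
  Quotient.eq (r := insepSetoid δ)

theorem insepClass_out (δ : Q → A → Option Q) (c : Quotient (insepSetoid δ)) :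
    insepClass δ c.out = c :=
  Quotient.out_eq c

/-- Inseparability is a right congruence. -/
theorem Insep.exists_stepWord {δ : Q → A → Option Q} {p q p' : Q} {w : List A} (h : Insep δ p q)
    (hp : stepWord δ p w = some p') : ∃ q', stepWord δ q w = some q' ∧ Insep δ p' q' := by
  have hq : (stepWord δ q w).isSome := (h w).1 (by simp [hp])
  obtain ⟨q', hq'⟩ := Option.isSome_iff_exists.1 hq
  refine ⟨q', hq', fun u => ?_⟩
  simpa [stepWord_append, hp, hq'] using h (w ++ u)

theorem stepWord_singleton (δ : Q → A → Option Q) (q : Q) (a : A) :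
    stepWord δ q [a] = δ q a := by
  simp only [stepWord]
  cases δ q a <;> rfl

theorem Insep.step {δ : Q → A → Option Q} {p q p' : Q} {a : A} (h : Insep δ p q)
    (hp : δ p a = some p') : ∃ q', δ q a = some q' ∧ Insep δ p' q' := by
  simpa only [stepWord_singleton] using
    h.exists_stepWord (w := [a]) (p' := p') (by rwa [stepWord_singleton])

theorem img_append (δ : Q → A → Option Q) (S : Set Q) (u v : List A) :
    img δ S (u ++ v) = img δ (img δ S u) v := by
  ext p
  simp only [img, Set.mem_ofPred_eq, stepWord_append, Option.bind_eq_some_iff]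
  constructor
  · rintro ⟨q, hq, r, hr, hp⟩
    exact ⟨r, ⟨q, hq, hr⟩, hp⟩
  · rintro ⟨r, ⟨q, hq, hr⟩, hp⟩
    exact ⟨q, hq, r, hr, hp⟩

theorem img_nil (δ : Q → A → Option Q) (S : Set Q) : img δ S [] = S := by
  ext p
  simp [img, stepWord]

/-- Applying a word that separates two states of `S` decreases the number of inseparability
classes met. -/
theorem ncard_insepClass_img_lt [Finite Q] (δ : Q → A → Option Q) (S : Set Q) (u : List A)
    {q : Q} (hq : q ∈ S) (hqu : stepWord δ q u = none) :
    (insepClass δ '' img δ S u).ncard < (insepClass δ '' S).ncard := by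
  have hfin : ∀ s : Set (Quotient (insepSetoid δ)), s.Finite := fun s => Set.toFinite s
  set D : Set Q := {p ∈ S | (stepWord δ p u).isSome} with hD
  let g : Quotient (insepSetoid δ) → Quotient (insepSetoid δ) := fun c =>
    (stepWord δ c.out u).elim c (insepClass δ)
  have h1 : insepClass δ '' img δ S u ⊆ g '' (insepClass δ '' D) := by
    rintro _ ⟨p', ⟨p, hp, hpp'⟩, rfl⟩
    refine ⟨_, ⟨p, ⟨hp, by simp [hpp']⟩, rfl⟩, ?_⟩
    have h2 : Insep δ p (insepClass δ p).out := by
      rw [← insepClass_eq_iff, insepClass_out]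
    obtain ⟨r, hr, hr'⟩ := h2.exists_stepWord hpp'
    simp only [g, hr, Option.elim_some]
    exact (insepClass_eq_iff.2 hr').symm
  have h3 : insepClass δ '' D ⊂ insepClass δ '' S := by
    refine ⟨Set.image_mono fun p hp => hp.1, fun hsub => ?_⟩
    obtain ⟨p, hp, hpq⟩ := hsub ⟨q, hq, rfl⟩
    have h4 := (insepClass_eq_iff.1 hpq u).1 hp.2
    simp [hqu] at h4
  calc _ ≤ (g '' (insepClass δ '' D)).ncard := Set.ncard_le_ncard h1 (hfin _)
    _ ≤ (insepClass δ '' D).ncard := Set.ncard_image_le (hfin _)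
    _ < _ := Set.ncard_lt_ncard h3 (hfin _)

/-- The functions that are constant on every inseparability class and on `S`. -/
def constOn (δ : Q → A → Option Q) (S : Set Q) : Submodule ℚ (Q → ℚ) where
  carrier := {f | (∀ p q, Insep δ p q → f p = f q) ∧ ∀ p ∈ S, ∀ q ∈ S, f p = f q}
  add_mem' := by
    rintro f g ⟨hf, hf'⟩ ⟨hg, hg'⟩
    exact ⟨fun p q h => by simp [hf p q h, hg p q h],
      fun p hp q hq => by simp [hf' p hp q hq, hg' p hp q hq]⟩
  zero_mem' := ⟨fun _ _ _ => rfl, fun _ _ _ _ => rfl⟩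
  smul_mem' := by
    rintro c f ⟨hf, hf'⟩
    exact ⟨fun p q h => by simp [hf p q h], fun p hp q hq => by simp [hf' p hp q hq]⟩

theorem finrank_constOn_add_le [Finite Q] (δ : Q → A → Option Q) {S : Set Q}
    (hS : S.Nonempty) :
    Module.finrank ℚ (constOn δ S) + (insepClass δ '' S).ncard ≤
      Nat.card (Quotient (insepSetoid δ)) + 1 := by
  have := Fintype.ofFinite Q
  have := Fintype.ofFinite (Quotient (insepSetoid δ))
  obtain ⟨s, hs⟩ := hS
  set R : Set (Quotient (insepSetoid δ)) := (insepClass δ '' S)ᶜ with hR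
  let φ : constOn δ S →ₗ[ℚ] (Option R → ℚ) :=
    { toFun := fun f x => x.elim (f.1 s) fun c => f.1 c.1.out
      map_add' := fun f g => by funext x; cases x <;> rfl
      map_smul' := fun c f => by funext x; cases x <;> rfl }
  have hφ : Function.Injective φ := by
    intro f g hfg
    apply Subtype.ext
    funext q
    by_cases hq : insepClass δ q ∈ R
    · have h1 := congrFun hfg (some ⟨_, hq⟩)
      have h2 : Insep δ q (insepClass δ q).out := by
        rw [← insepClass_eq_iff, insepClass_out]
      rw [f.2.1 _ _ h2, g.2.1 _ _ h2]
      exact h1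
    · rw [hR, Set.notMem_compl_iff] at hq
      obtain ⟨p, hp, hpq⟩ := hq
      have h1 : f.1 s = g.1 s := congrFun hfg none
      have h2 := insepClass_eq_iff.1 hpq
      rw [← f.2.1 _ _ h2, ← g.2.1 _ _ h2, f.2.2 p hp s hs, g.2.2 p hp s hs, h1]
  have h1 := LinearMap.finrank_le_finrank_of_injective hφ
  rw [Module.finrank_fintype_fun_eq_card, Fintype.card_option, ← Nat.card_eq_fintype_card,
    Nat.card_coe_set_eq] at h1
  have h2 := Set.ncard_add_ncard_compl (insepClass δ '' S)
  rw [← hR] at h2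
  omega

/-- A set of states meeting several inseparability classes is separated by a short word. -/
theorem exists_short_separating [Finite Q] (δ : Q → A → Option Q) (S : Set Q)
    (hS : 1 < (insepClass δ '' S).ncard) :
    ∃ u : List A, u.length + (insepClass δ '' S).ncard ≤
      Nat.card (Quotient (insepSetoid δ)) + 1 ∧
      (img δ S u).Nonempty ∧ ∃ q ∈ S, stepWord δ q u = none := by
  have := Fintype.ofFinite Q
  obtain ⟨_, _, ⟨p, hp, rfl⟩, ⟨q, hq, rfl⟩, hpq⟩ := (Set.one_lt_ncard_iff (Set.toFinite _)).1 hS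
  have hval : ∀ w r, linAct (pullback δ) w 1 r = if (stepWord δ r w).isSome then 1 else 0 := by
    intro w r
    rw [linAct_pullback]
    cases stepWord δ r w <;> simp
  have hex : ∃ w, linAct (pullback δ) w 1 ∉ constOn δ S := by
    by_contra! hcon
    apply hpq
    rw [insepClass_eq_iff]
    intro u
    have := (hcon u).2 p hp q hq
    rw [hval, hval] at this
    by_cases h1 : (stepWord δ p u).isSome <;> by_cases h2 : (stepWord δ q u).isSome <;>
      simp_all
  obtain ⟨u, hu, hu'⟩ := exists_short_linAct_notMem _ _ _ hex
  have hsep : ∃ r ∈ S, ∃ t ∈ S, (stepWord δ r u).isSome ∧ ¬ (stepWord δ t u).isSome := by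
    by_contra! hcon
    refine hu' ⟨fun r t hrt => ?_, fun r hr t ht => ?_⟩
    · rw [hval, hval]
      simp only [hrt u]
    · rw [hval, hval]
      have : (stepWord δ r u).isSome ↔ (stepWord δ t u).isSome :=
        ⟨hcon r hr t ht, hcon t ht r hr⟩
      simp only [this]
  obtain ⟨r, hr, t, ht, hru, htu⟩ := hsep
  have hfin := finrank_constOn_add_le δ ⟨p, hp⟩
  obtain ⟨r', hr'⟩ := Option.isSome_iff_exists.1 hru
  exact ⟨u, by omega, ⟨r', r, hr, hr'⟩, t, ht, by simpa using htu⟩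

theorem exists_short_to_class_aux [Finite Q] (δ : Q → A → Option Q) (j : ℕ) (S : Set Q)
    (hS : S.Nonempty) (hj : (insepClass δ '' S).ncard ≤ j + 1) :
    ∃ w : List A, w.length ≤
        ∑ i ∈ Finset.range j, (Nat.card (Quotient (insepSetoid δ)) - 1 - i) ∧
      (img δ S w).Nonempty ∧ (insepClass δ '' img δ S w).ncard = 1 := by
  induction j generalizing S with
  | zero =>
    have := (Set.ncard_pos (Set.toFinite _)).2 (hS.image (insepClass δ))
    exact ⟨[], by simp, by rwa [img_nil], by rw [img_nil]; omega⟩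
  | succ j ih =>
    rcases Nat.lt_or_ge (j + 1) (insepClass δ '' S).ncard with h | h
    · obtain ⟨u, hu, hne, q, hq, hqu⟩ := exists_short_separating δ S (by omega)
      have hlt := ncard_insepClass_img_lt δ S u hq hqu
      obtain ⟨v, hv, hv'⟩ := ih (img δ S u) hne (by omega)
      refine ⟨u ++ v, ?_, by rwa [img_append]⟩
      rw [Finset.sum_range_succ, List.length_append]
      omega
    · obtain ⟨v, hv, hv'⟩ := ih S hS h
      refine ⟨v, hv.trans ?_, hv'⟩
      rw [Finset.sum_range_succ]
      omega

/-- A word of length at most `m (m - 1) / 2`, where `m` is the number of inseparability classes,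
brings the set of all states into one class. -/
theorem exists_short_to_class [Finite Q] [Nonempty Q] (δ : Q → A → Option Q) :
    ∃ w : List A, w.length ≤ Nat.card (Quotient (insepSetoid δ)) *
        (Nat.card (Quotient (insepSetoid δ)) - 1) / 2 ∧
      ∃ q, (∃ p, stepWord δ p w = some q) ∧
        ∀ p r, stepWord δ p w = some r → Insep δ q r := by
  have hle : (insepClass δ '' Set.univ).ncard ≤ Nat.card (Quotient (insepSetoid δ)) := by
    rw [← Set.ncard_univ]
    exact Set.ncard_le_ncard (Set.subset_univ _) (Set.toFinite _)
  set m := Nat.card (Quotient (insepSetoid δ)) with hm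
  obtain ⟨w, hw, ⟨q, p, -, hq⟩, h1⟩ :=
    exists_short_to_class_aux δ (m - 1) Set.univ Set.univ_nonempty (by omega)
  refine ⟨w, hw.trans_eq ?_, q, ⟨p, hq⟩, fun p' r hr => ?_⟩
  · rw [← hm, ← Finset.sum_range_id, ← Finset.sum_range_reflect (fun i => i) m]
    rcases Nat.eq_zero_or_pos m with h0 | h0
    · simp [h0]
    · obtain ⟨k, hk⟩ : ∃ k, m = k + 1 := ⟨m - 1, by omega⟩
      rw [hk, Finset.sum_range_succ]
      simp
  · rw [← insepClass_eq_iff]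
    obtain ⟨c, hc⟩ := Set.ncard_eq_one.1 h1
    have e1 : insepClass δ q ∈ insepClass δ '' img δ Set.univ w := ⟨q, ⟨p, trivial, hq⟩, rfl⟩
    have e2 : insepClass δ r ∈ insepClass δ '' img δ Set.univ w := ⟨r, ⟨p', trivial, hr⟩, rfl⟩
    rw [hc, Set.mem_singleton_iff] at e1 e2
    rw [e1, e2]

end Inseparability

section ClassReset

variable {Q A : Type*}

theorem exists_reset_class (δ : Q → A → Option Q) (hδ : StronglyConnected δ)
    (h : ∃ w : List A, (img δ Set.univ w).ncard = 1) (q₀ : Q) :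
    ∃ (u : List A) (x : Q), ∀ q, Insep δ q₀ q → stepWord δ q u = some x := by
  obtain ⟨w, hw⟩ := h
  obtain ⟨x, hx⟩ := Set.ncard_eq_one.1 hw
  have hxm : x ∈ img δ Set.univ w := by simp [hx]
  obtain ⟨p, -, hp⟩ := hxm
  obtain ⟨v, hv⟩ := hδ q₀ p
  refine ⟨v ++ w, x, fun q hq => ?_⟩
  obtain ⟨p', hp', hpp'⟩ := hq.exists_stepWord hv
  obtain ⟨y, hy, -⟩ := hpp'.exists_stepWord hp
  have hyx : y ∈ img δ Set.univ w := ⟨p', trivial, hy⟩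
  rw [hx, Set.mem_singleton_iff] at hyx
  rw [stepWord_append, hp', Option.bind_some, hy, hyx]

/-- The words of length at most `N` that map the inseparability class of `q₀` into itself. -/
abbrev ReturnWord (δ : Q → A → Option Q) (q₀ : Q) (N : ℕ) : Type _ :=
  {u : List A // u.length ≤ N ∧
    ∀ q : {q // Insep δ q₀ q}, ∃ p : {q // Insep δ q₀ q}, stepWord δ q.1 u = some p.1}

/-- The complete DFA induced on an inseparability class by short return words. -/
noncomputable def returnDelta (δ : Q → A → Option Q) (q₀ : Q) (N : ℕ) (q : {q // Insep δ q₀ q})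
    (u : ReturnWord δ q₀ N) : {q // Insep δ q₀ q} :=
  (u.2.2 q).choose

theorem stepWord_returnWord (δ : Q → A → Option Q) (q₀ : Q) (N : ℕ) (q : {q // Insep δ q₀ q})
    (u : ReturnWord δ q₀ N) : stepWord δ q.1 u.1 = some (returnDelta δ q₀ N q u).1 :=
  (u.2.2 q).choose_spec

theorem stepWord_flatten_returnWord (δ : Q → A → Option Q) (q₀ : Q) (N : ℕ)
    (ws : List (ReturnWord δ q₀ N)) (q : {q // Insep δ q₀ q}) :
    stepWord δ q.1 (ws.map Subtype.val).flatten =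
      some (stepWordC (returnDelta δ q₀ N) q ws).1 := by
  induction ws generalizing q with
  | nil => rfl
  | cons u ws ih =>
    rw [List.map_cons, List.flatten_cons, stepWord_append, stepWord_returnWord,
      Option.bind_some, ih]
    rfl

theorem length_flatten_returnWord_le (δ : Q → A → Option Q) (q₀ : Q) (N : ℕ)
    (ws : List (ReturnWord δ q₀ N)) :
    (ws.map Subtype.val).flatten.length ≤ N * ws.length := by
  induction ws with
  | nil => simp
  | cons u ws ih =>
    rw [List.map_cons, List.flatten_cons, List.length_append, List.length_cons, Nat.mul_succ]
    have := u.2.1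
    omega

/-- Return words of length at most the number of states synchronize the class of `q₀`. -/
theorem exists_reset_returnDelta [Fintype Q] (δ : Q → A → Option Q) (hδ : StronglyConnected δ)
    (h : ∃ w : List A, (img δ Set.univ w).ncard = 1) (q₀ : Q) :
    ∃ ws, (imgC (returnDelta δ q₀ (Fintype.card Q)) Set.univ ws).ncard = 1 := by
  have : Nonempty {q // Insep δ q₀ q} := ⟨⟨q₀, fun _ => Iff.rfl⟩⟩
  set D := returnDelta δ q₀ (Fintype.card Q) with hD
  refine exists_reset_of_rank_decrease D fun w hw => ?_
  set P := imgC D Set.univ w with hP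
  obtain ⟨y₁, y₂, hy₁, hy₂, hne⟩ := (Set.one_lt_ncard_iff (Set.toFinite _)).1 hw
  let g : {q // Insep δ q₀ q} → Q → ℚ := fun y q =>
    if h : Insep δ q₀ q then if stepWordC D ⟨q, h⟩ w = y then 1 else 0 else 0
  have hg : ∀ y (z : {q // Insep δ q₀ q}), g y z.1 = if stepWordC D z w = y then 1 else 0 :=
    fun y z => by simp [g, z.2]
  let φ : (Q → ℚ) →ₗ[ℚ] ℚ :=
    ∑ q ∈ P.toFinset, LinearMap.proj (R := ℚ) (φ := fun _ : Q => ℚ) q.1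
  have hφ : ∀ f, φ f = ∑ q ∈ P.toFinset, f q.1 := fun f => by simp [φ]
  obtain ⟨u, hu, hu'⟩ := exists_short_linAct_notMem (pullback δ) (g y₁ - g y₂)
    (LinearMap.ker φ) (by
      obtain ⟨u, x, hux⟩ := exists_reset_class δ hδ h q₀
      obtain ⟨z, -, hz⟩ := hy₁
      obtain ⟨v, hv⟩ := hδ x z.1
      refine ⟨u ++ v, ?_⟩
      have hval : ∀ q ∈ P.toFinset, linAct (pullback δ) (u ++ v) (g y₁ - g y₂) q.1 = 1 := by
        intro q _
        have hz' : stepWordC D z w = y₁ := hz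
        rw [linAct_pullback, stepWord_append, hux q.1 q.2, Option.bind_some, hv,
          Option.elim_some, Pi.sub_apply, hg, hg, hz']
        simp [hne]
      rw [LinearMap.mem_ker, hφ, Finset.sum_congr rfl hval]
      have : P.toFinset.Nonempty := ⟨y₁, by simpa using ⟨z, trivial, hz⟩⟩
      rw [Finset.sum_const, nsmul_eq_mul, mul_one]
      exact_mod_cast this.card_ne_zero)
  rw [LinearMap.mem_ker, hφ] at hu'
  obtain ⟨q, hq, hqu⟩ := Finset.exists_ne_zero_of_sum_ne_zero hu'
  have hret : ∀ p : {q // Insep δ q₀ q}, ∃ p' : {q // Insep δ q₀ q},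
      stepWord δ p.1 u = some p'.1 := by
    rw [linAct_pullback] at hqu
    cases hr : stepWord δ q.1 u with
    | none => simp [hr] at hqu
    | some r =>
      have hrK : Insep δ q₀ r := by
        by_contra hr'
        simp [hr, g, hr'] at hqu
      intro p
      have hqp : Insep δ q.1 p.1 := fun u => (q.2 u).symm.trans (p.2 u)
      obtain ⟨p', hp', hrp⟩ := hqp.exists_stepWord hr
      exact ⟨⟨p', fun u => (hrK u).trans (hrp u)⟩, hp'⟩
  let ℓ : ReturnWord δ q₀ (Fintype.card Q) :=
    ⟨u, hu.trans ((Submodule.finrank_le _).trans_eq (by simp)), hret⟩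
  refine ⟨w ++ ([ℓ] ++ w), ?_⟩
  have himg : imgC D Set.univ (w ++ ([ℓ] ++ w)) = (fun q => stepWordC D (D q ℓ) w) '' P := by
    rw [imgC_append, ← hP]
    rfl
  rw [himg]
  have hsub : (fun q => stepWordC D (D q ℓ) w) '' P ⊆ P := by
    rintro _ ⟨q, -, rfl⟩
    exact ⟨_, trivial, rfl⟩
  refine lt_of_le_of_ne (Set.ncard_le_ncard hsub (Set.toFinite _)) fun heq => hu' ?_
  have hinj := Set.injOn_of_ncard_image_eq heq (Set.toFinite P)
  have hsurj := Set.eq_of_subset_of_ncard_le hsub heq.ge (Set.toFinite _)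
  have hone : ∀ y ∈ P,
      ∑ q ∈ P.toFinset, (if stepWordC D (D q ℓ) w = y then (1 : ℚ) else 0) = 1 := by
    intro y hy
    rw [← hsurj] at hy
    obtain ⟨z, hz, hzy⟩ := hy
    rw [Finset.sum_eq_single_of_mem z (by simpa using hz), if_pos hzy]
    intro b hb hbz
    rw [if_neg]
    intro hby
    exact hbz (hinj (by simpa using hb) hz (hby.trans hzy.symm))
  have hterm : ∀ q ∈ P.toFinset, linAct (pullback δ) u (g y₁ - g y₂) q.1 =
      (if stepWordC D (D q ℓ) w = y₁ then (1 : ℚ) else 0) -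
        if stepWordC D (D q ℓ) w = y₂ then (1 : ℚ) else 0 := by
    intro q _
    have := stepWord_returnWord δ q₀ _ q ℓ
    rw [linAct_pullback, this, Option.elim_some, Pi.sub_apply, hg, hg]
  rw [Finset.sum_congr rfl hterm, Finset.sum_sub_distrib, hone y₁ hy₁, hone y₂ hy₂, sub_self]

/-- A class of size `k` has a reset word of length at most `n k³`. -/
theorem exists_reset_class_le_cube [Fintype Q] (δ : Q → A → Option Q) (hδ : StronglyConnected δ)
    (h : ∃ w : List A, (img δ Set.univ w).ncard = 1) (q₀ : Q) :
    ∃ u : List A, u.length ≤ Fintype.card Q * {q | Insep δ q₀ q}.ncard ^ 3 ∧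
      ∃ x, ∀ q, Insep δ q₀ q → stepWord δ q u = some x := by
  have : Nonempty {q // Insep δ q₀ q} := ⟨⟨q₀, fun _ => Iff.rfl⟩⟩
  obtain ⟨ws, hws, hws'⟩ := exists_reset_le_cube _ (exists_reset_returnDelta δ hδ h q₀)
  obtain ⟨x, hx⟩ := Set.ncard_eq_one.1 hws'
  have hcard : Fintype.card {q // Insep δ q₀ q} = {q | Insep δ q₀ q}.ncard := by
    rw [← Nat.card_eq_fintype_card, ← Nat.card_coe_set_eq]
    rfl
  rw [hcard] at hws
  refine ⟨_, (length_flatten_returnWord_le _ _ _ ws).trans (Nat.mul_le_mul_left _ hws), x.1,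
    fun q hq => ?_⟩
  have hmem : stepWordC (returnDelta δ q₀ (Fintype.card Q)) ⟨q, hq⟩ ws ∈ ({x} : Set _) :=
    hx ▸ ⟨⟨q, hq⟩, trivial, rfl⟩
  rw [stepWord_flatten_returnWord δ q₀ _ ws ⟨q, hq⟩, Set.mem_singleton_iff.1 hmem]

end ClassReset

section Completion

variable {Q A : Type*}

/-- The distance from a state to the inseparability class of `q₀`. -/
noncomputable def classDist (δ : Q → A → Option Q) (q₀ q : Q) : ℕ :=
  sInf {k | ∃ w : List A, w.length = k ∧ ∃ p, stepWord δ q w = some p ∧ Insep δ q₀ p}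

theorem classDist_congr {δ : Q → A → Option Q} (q₀ : Q) {p q : Q} (h : Insep δ p q) :
    classDist δ q₀ p = classDist δ q₀ q := by
  have key : ∀ {p q : Q}, Insep δ p q → ∀ w : List A,
      (∃ r, stepWord δ p w = some r ∧ Insep δ q₀ r) →
      ∃ r, stepWord δ q w = some r ∧ Insep δ q₀ r := by
    rintro p q h w ⟨r, hr, hr'⟩
    obtain ⟨s, hs, hrs⟩ := h.exists_stepWord hr
    exact ⟨s, hs, fun u => (hr' u).trans (hrs u)⟩
  unfold classDist
  congr 1
  ext k
  constructor
  · rintro ⟨w, hw, hw'⟩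
    exact ⟨w, hw, key h w hw'⟩
  · rintro ⟨w, hw, hw'⟩
    exact ⟨w, hw, key (fun u => (h u).symm) w hw'⟩

theorem exists_classDist_lt (δ : Q → A → Option Q) (hδ : StronglyConnected δ) (q₀ q : Q)
    (hq : ¬ Insep δ q₀ q) :
    ∃ a p, δ q a = some p ∧ classDist δ q₀ p < classDist δ q₀ q := by
  obtain ⟨v, hv⟩ := hδ q q₀
  obtain ⟨w, hw, p, hp, hp'⟩ : classDist δ q₀ q ∈ {k | ∃ w : List A, w.length = k ∧
      ∃ p, stepWord δ q w = some p ∧ Insep δ q₀ p} :=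
    Nat.sInf_mem ⟨v.length, v, rfl, q₀, hv, fun _ => Iff.rfl⟩
  cases w with
  | nil =>
    simp only [stepWord, Option.some_inj] at hp
    exact absurd (hp ▸ hp') hq
  | cons a w =>
    simp only [stepWord, Option.bind_eq_some_iff] at hp
    obtain ⟨r, hr, hrp⟩ := hp
    refine ⟨a, r, hr, ?_⟩
    have : classDist δ q₀ r ≤ w.length := Nat.sInf_le ⟨w, rfl, p, hrp, hp'⟩
    rw [List.length_cons] at hw
    omega

/-- There is a map that fixes the class of `q₀`, acts on every other class as some letter, and
moves all states outside of the class of `q₀` closer to it. -/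
theorem exists_collecting_map (δ : Q → A → Option Q) (hδ : StronglyConnected δ) (q₀ : Q) :
    ∃ f : Q → Q, (∀ q, Insep δ q₀ q → f q = q) ∧
      (∀ q, ¬ Insep δ q₀ q → classDist δ q₀ (f q) < classDist δ q₀ q) ∧
      ∀ q, ¬ Insep δ q₀ q → ∃ a, ∀ p, Insep δ q p → δ p a = some (f p) := by
  have hex : ∀ c : Quotient (insepSetoid δ), ∃ o : Option A, ¬ Insep δ q₀ c.out →
      ∃ a p, o = some a ∧ δ c.out a = some p ∧
        classDist δ q₀ p < classDist δ q₀ c.out := by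
    intro c
    by_cases hc : Insep δ q₀ c.out
    · exact ⟨none, fun h => absurd hc h⟩
    · obtain ⟨a, p, h⟩ := exists_classDist_lt δ hδ q₀ _ hc
      exact ⟨some a, fun _ => ⟨a, p, rfl, h⟩⟩
  choose o ho using hex
  let f : Q → Q := fun q =>
    if Insep δ q₀ q then q else ((o (insepClass δ q)).bind fun a => δ q a).getD q
  have key : ∀ q, ¬ Insep δ q₀ q → ∃ a, ∀ p, Insep δ q p →
      δ p a = some (f p) ∧ classDist δ q₀ (f p) < classDist δ q₀ p := by
    intro q hq
    have hout : Insep δ (insepClass δ q).out q := by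
      rw [← insepClass_eq_iff, insepClass_out]
    obtain ⟨a, r, hoa, har, hlt⟩ := ho (insepClass δ q)
      fun h => hq fun u => (h u).trans (hout u)
    refine ⟨a, fun p hp => ?_⟩
    have hop : Insep δ (insepClass δ q).out p := fun u => (hout u).trans (hp u)
    obtain ⟨s, hs, hrs⟩ := hop.step har
    have hfp : f p = s := by
      have hqp : ¬ Insep δ q₀ p := fun h => hq fun u => (h u).trans (hp u).symm
      simp only [f, if_neg hqp, ← insepClass_eq_iff.2 hp, hoa, Option.bind_some, hs,
        Option.getD_some]
    rw [hfp]
    refine ⟨hs, ?_⟩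
    rwa [← classDist_congr q₀ hrs, ← classDist_congr q₀ hop]
  refine ⟨f, fun q hq => if_pos hq, fun q hq => ?_, fun q hq => ?_⟩
  · obtain ⟨a, ha⟩ := key q hq
    exact (ha q fun _ => Iff.rfl).2
  · obtain ⟨a, ha⟩ := key q hq
    exact ⟨a, fun p hp => (ha p hp).1⟩

/-- The fixing automaton with an additional letter acting as `f`. -/
def collectDelta (δ : Q → A → Option Q) (f : Q → Q) (q : Q) (o : Option A) : Q :=
  o.elim (f q) (fixDelta δ q)

/-- On an inseparability class, a word over the extended alphabet can be simulated by a word of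
the partial DFA that is not longer. -/
theorem exists_simulating_word {δ : Q → A → Option Q} {q₀ : Q} {f : Q → Q}
    (hf₁ : ∀ q, Insep δ q₀ q → f q = q)
    (hf₂ : ∀ q, ¬ Insep δ q₀ q → ∃ a, ∀ p, Insep δ q p → δ p a = some (f p))
    (w : List (Option A)) (q : Q) :
    ∃ u : List A, u.length ≤ w.length ∧
      ∀ p, Insep δ q p → stepWord δ p u = some (stepWordC (collectDelta δ f) p w) := by
  induction w generalizing q with
  | nil => exact ⟨[], le_rfl, fun _ _ => rfl⟩
  | cons o w ih =>
    have hcase : (∀ p, Insep δ q p → collectDelta δ f p o = p) ∨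
        ∃ b, ∀ p, Insep δ q p → δ p b = some (collectDelta δ f p o) := by
      cases o with
      | none =>
        by_cases hq : Insep δ q₀ q
        · exact Or.inl fun p hp => hf₁ p fun u => (hq u).trans (hp u)
        · exact Or.inr (hf₂ q hq)
      | some a =>
        cases ha : δ q a with
        | none =>
          refine Or.inl fun p hp => ?_
          have hpa : δ p a = none := by
            have := hp [a]
            simpa [stepWord_singleton, ha] using this
          simp [collectDelta, fixDelta, hpa]
        | some r =>
          refine Or.inr ⟨a, fun p hp => ?_⟩
          obtain ⟨s, hs, -⟩ := hp.step ha
          simp [collectDelta, fixDelta, hs]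
    rcases hcase with hid | ⟨b, hb⟩
    · obtain ⟨u, hu, hu'⟩ := ih q
      refine ⟨u, hu.trans (Nat.le_succ _), fun p hp => ?_⟩
      rw [hu' p hp]
      simp only [stepWordC, List.foldl_cons, hid p hp]
    · obtain ⟨u, hu, hu'⟩ := ih (collectDelta δ f q o)
      refine ⟨b :: u, Nat.succ_le_succ hu, fun p hp => ?_⟩
      obtain ⟨s, hs, hqs⟩ := hp.step (hb q fun _ => Iff.rfl)
      rw [hb p hp, Option.some_inj] at hs
      simp only [stepWord, hb p hp, Option.bind_some]
      rw [hu' _ (hs ▸ hqs)]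
      rfl

theorem stepWordC_map_some {δ : Q → A → Option Q} (f : Q → Q) {q p : Q} {w : List A}
    (h : stepWord δ q w = some p) :
    stepWordC (collectDelta δ f) q (w.map some) = p := by
  induction w generalizing q with
  | nil => simpa [stepWord, stepWordC] using h
  | cons a w ih =>
    simp only [stepWord, Option.bind_eq_some_iff] at h
    obtain ⟨r, hr, hrp⟩ := h
    have := ih hrp
    simpa [stepWordC, collectDelta, fixDelta, hr] using this

theorem insep_stepWordC_replicate {δ : Q → A → Option Q} {q₀ : Q} {f : Q → Q}
    (hf₁ : ∀ q, Insep δ q₀ q → f q = q)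
    (hf₂ : ∀ q, ¬ Insep δ q₀ q → classDist δ q₀ (f q) < classDist δ q₀ q) (k : ℕ) (q : Q)
    (hk : classDist δ q₀ q ≤ k) :
    Insep δ q₀ (stepWordC (collectDelta δ f) q (List.replicate k none)) := by
  induction k generalizing q with
  | zero =>
    by_contra hq
    have := hf₂ q hq
    omega
  | succ k ih =>
    change Insep δ q₀ (stepWordC (collectDelta δ f) (f q) (List.replicate k none))
    apply ih
    by_cases hq : Insep δ q₀ q
    · have : classDist δ q₀ q = 0 := Nat.le_zero.1 (Nat.sInf_le ⟨[], rfl, q, rfl, hq⟩)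
      rw [hf₁ q hq]
      omega
    · have := hf₂ q hq
      omega

/-- An upper bound on the reset thresholds of complete DFAs is an upper bound on the lengths of
shortest reset words of inseparability classes. -/
theorem exists_reset_class_le_of_complete {n C : ℕ}
    (hC : ∀ (Q A : Type) [Fintype Q] [Fintype A] (δc : Q → A → Q),
      Fintype.card Q = n →
      (∃ w : List A, (imgC δc Set.univ w).ncard = 1) →
      sInf {k : ℕ | ∃ w : List A, w.length = k ∧ (imgC δc Set.univ w).ncard = 1} ≤ C)
    {Q A : Type} [Fintype Q] [Fintype A] (δ : Q → A → Option Q) (hn : Fintype.card Q = n)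
    (hδ : StronglyConnected δ) (h : ∃ w : List A, (img δ Set.univ w).ncard = 1) (q₀ : Q) :
    ∃ u : List A, u.length ≤ C ∧ ∃ x, ∀ q, Insep δ q₀ q → stepWord δ q u = some x := by
  obtain ⟨f, hf₁, hf₂, hf₃⟩ := exists_collecting_map δ hδ q₀
  have hsync : ∃ w : List (Option A), (imgC (collectDelta δ f) Set.univ w).ncard = 1 := by
    obtain ⟨u, x, hux⟩ := exists_reset_class δ hδ h q₀
    refine ⟨List.replicate (Finset.univ.sup (classDist δ q₀)) none ++ u.map some, ?_⟩
    rw [Set.ncard_eq_one]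
    refine ⟨x, Set.eq_singleton_iff_nonempty_unique_mem.2
      ⟨Set.Nonempty.image _ ⟨q₀, trivial⟩, ?_⟩⟩
    rintro _ ⟨q, -, rfl⟩
    dsimp only
    rw [stepWordC_append]
    exact stepWordC_map_some f (hux _ (insep_stepWordC_replicate hf₁ hf₂ _ q
      (Finset.le_sup (f := classDist δ q₀) (Finset.mem_univ q))))
  obtain ⟨w, hw, hw'⟩ := Nat.sInf_mem (s := {k : ℕ | ∃ w : List (Option A), w.length = k ∧
    (imgC (collectDelta δ f) Set.univ w).ncard = 1})
    (hsync.imp' List.length fun w hw => ⟨w, rfl, hw⟩)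
  have hle := hC Q (Option A) (collectDelta δ f) hn hsync
  obtain ⟨x, hx⟩ := Set.ncard_eq_one.1 hw'
  obtain ⟨u, hu, hu'⟩ := exists_simulating_word hf₁ hf₃ w q₀
  refine ⟨u, by omega, x, fun q hq => ?_⟩
  have hmem : stepWordC (collectDelta δ f) q w ∈ ({x} : Set Q) := hx ▸ ⟨q, trivial, rfl⟩
  rw [hu' q hq, Set.mem_singleton_iff.1 hmem]

end Completion

section LowerBound

/-- The `i`-th letter exchanges `i` and `i - 1` for `i ≥ 2`, and maps `1` to `0` for `i = 1`. -/
def descend (i q : ℕ) : ℕ := if q = i then i - 1 else if q + 1 = i ∧ q ≠ 0 then i else q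

theorem descend_lt {n i q : ℕ} (hi : i < n) (hq : q < n) : descend i q < n := by
  unfold descend
  split_ifs <;> omega

theorem sum_le_sum_image_descend (i : ℕ) (S : Finset ℕ) :
    ∑ x ∈ S, x ≤ ∑ x ∈ S.image (descend i), x + 1 := by
  have hinj : Set.InjOn (descend i) (S.erase 0) := by
    intro x hx y hy hxy
    simp only [Finset.coe_erase, Set.mem_sdiff, Set.mem_singleton_iff] at hx hy
    have hx0 := hx.2
    have hy0 := hy.2
    unfold descend at hxy
    split_ifs at hxy <;> omega
  have h1 : ∑ x ∈ (S.erase 0).image (descend i), x ≤ ∑ x ∈ S.image (descend i), x :=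
    Finset.sum_le_sum_of_subset (Finset.image_subset_image (Finset.erase_subset _ _))
  rw [Finset.sum_image hinj] at h1
  have h2 : ∑ x ∈ S, x = ∑ x ∈ S.erase 0, x := (Finset.sum_erase S rfl).symm
  have h3 : ∑ x ∈ S.erase 0, x ≤ ∑ x ∈ S.erase 0, (descend i x + if x = i then 1 else 0) := by
    apply Finset.sum_le_sum
    intro x _
    unfold descend
    split_ifs <;> omega
  have h4 : ∑ x ∈ S.erase 0, (if x = i then 1 else 0) ≤ 1 := by
    rw [Finset.sum_ite_eq']
    split_ifs <;> omega
  rw [Finset.sum_add_distrib] at h3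
  omega

/-- The complete DFA on `Fin n` whose letters act by `descend`. -/
def descendDelta (n : ℕ) (q i : Fin n) : Fin n := ⟨descend i q, descend_lt i.2 q.2⟩

theorem sum_le_sum_image_descendDelta (n : ℕ) (w : List (Fin n)) (S : Finset (Fin n)) :
    ∑ x ∈ S, (x : ℕ) ≤
      ∑ x ∈ S.image (fun q => stepWordC (descendDelta n) q w), (x : ℕ) + w.length := by
  induction w generalizing S with
  | nil => simp [stepWordC]
  | cons i w ih =>
    have h1 := ih (S.image fun q => descendDelta n q i)
    rw [Finset.image_image] at h1
    have h2 := sum_le_sum_image_descend i (S.image Fin.val)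
    have hv : ∀ T : Finset (Fin n), ∑ x ∈ T.image Fin.val, x = ∑ x ∈ T, (x : ℕ) :=
      fun T => Finset.sum_image (Fin.val_injective.injOn)
    have h3 : (S.image Fin.val).image (descend i) =
        (S.image fun q => descendDelta n q i).image Fin.val := by
      rw [Finset.image_image, Finset.image_image]
      rfl
    rw [h3, hv, hv] at h2
    rw [List.length_cons]
    have h4 : (fun q => stepWordC (descendDelta n) q (i :: w)) =
        (fun q => stepWordC (descendDelta n) q w) ∘ fun q => descendDelta n q i := rfl
    rw [h4]
    omega

theorem stepWordC_descendDelta_zero {n : ℕ} (hn : 0 < n) (w : List (Fin n)) :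
    stepWordC (descendDelta n) ⟨0, hn⟩ w = ⟨0, hn⟩ := by
  induction w with
  | nil => rfl
  | cons i w ih =>
    have : descendDelta n ⟨0, hn⟩ i = ⟨0, hn⟩ := by
      apply Fin.ext
      simp only [descendDelta, descend]
      split_ifs <;> omega
    change stepWordC (descendDelta n) (descendDelta n ⟨0, hn⟩ i) w = _
    rw [this, ih]

theorem exists_stepWordC_descendDelta_eq_zero {n : ℕ} (hn : 0 < n) (k : ℕ) (hk : k < n) :
    ∃ w : List (Fin n), w.length ≤ k ∧ stepWordC (descendDelta n) ⟨k, hk⟩ w = ⟨0, hn⟩ := by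
  induction k with
  | zero => exact ⟨[], le_rfl, rfl⟩
  | succ k ih =>
    obtain ⟨w, hw, hw'⟩ := ih (by omega)
    refine ⟨⟨k + 1, hk⟩ :: w, Nat.succ_le_succ hw, ?_⟩
    rw [← hw']
    change stepWordC _ (descendDelta n _ _) w = _
    congr 1
    simp [descendDelta, descend]

/-- The maximal reset threshold of complete DFAs with `n` states is at least `n (n - 1) / 2`. -/
theorem mul_pred_div_two_le_of_complete {n C : ℕ} (hn : 0 < n)
    (hC : ∀ (Q A : Type) [Fintype Q] [Fintype A] (δc : Q → A → Q),
      Fintype.card Q = n →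
      (∃ w : List A, (imgC δc Set.univ w).ncard = 1) →
      sInf {k : ℕ | ∃ w : List A, w.length = k ∧ (imgC δc Set.univ w).ncard = 1} ≤ C) :
    n * (n - 1) / 2 ≤ C := by
  have hsync : ∃ w : List (Fin n), (imgC (descendDelta n) Set.univ w).ncard = 1 := by
    obtain ⟨w, -, hw⟩ := exists_reset_of_merge (descendDelta n) (n + n) (fun p q => by
      obtain ⟨u, hu, hu'⟩ := exists_stepWordC_descendDelta_eq_zero hn p.1 p.2
      obtain ⟨v, hv, hv'⟩ := exists_stepWordC_descendDelta_eq_zero hn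
        (stepWordC (descendDelta n) q u).1 (stepWordC (descendDelta n) q u).2
      refine ⟨u ++ v, ?_, ?_⟩
      · rw [List.length_append]
        omega
      · rw [stepWordC_append, stepWordC_append, hv', hu', stepWordC_descendDelta_zero])
      n Set.univ ⟨⟨0, hn⟩, trivial⟩ (by simp [Set.ncard_univ])
    exact ⟨w, hw⟩
  obtain ⟨w, hw, hw'⟩ := Nat.sInf_mem (s := {k : ℕ | ∃ w : List (Fin n), w.length = k ∧
    (imgC (descendDelta n) Set.univ w).ncard = 1})
    (hsync.imp' List.length fun w hw => ⟨w, rfl, hw⟩)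
  refine le_trans ?_ (hC (Fin n) (Fin n) (descendDelta n) (Fintype.card_fin n) hsync)
  rw [← hw]
  obtain ⟨x, hx⟩ := Set.ncard_eq_one.1 hw'
  have hx' : ∀ q, stepWordC (descendDelta n) q w = x := fun q => by
    have : stepWordC (descendDelta n) q w ∈ ({x} : Set (Fin n)) := hx ▸ ⟨q, trivial, rfl⟩
    exact this
  have hx0 : x = ⟨0, hn⟩ := by
    rw [← hx' ⟨0, hn⟩, stepWordC_descendDelta_zero]
  have h1 := sum_le_sum_image_descendDelta n w Finset.univ
  have h2 : ∑ x ∈ Finset.univ.image (fun q => stepWordC (descendDelta n) q w), (x : ℕ) = 0 := by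
    apply Finset.sum_eq_zero
    intro y hy
    obtain ⟨q, -, rfl⟩ := Finset.mem_image.1 hy
    rw [hx' q, hx0]
  rw [h2, zero_add, Fin.sum_univ_eq_sum_range (fun i => i) n, Finset.sum_range_id] at h1
  exact h1

end LowerBound

section Threshold

variable {Q A : Type*}

theorem sInf_resetLength_le {δ : Q → A → Option Q} {w : List A} {x : Q}
    (hne : ∃ p, stepWord δ p w = some x) (h : ∀ p y, stepWord δ p w = some y → y = x) :
    sInf {k : ℕ | ∃ w : List A, w.length = k ∧ (img δ Set.univ w).ncard = 1} ≤ w.length := by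
  refine Nat.sInf_le ⟨w, rfl, Set.ncard_eq_one.2 ⟨x, ?_⟩⟩
  obtain ⟨p, hp⟩ := hne
  refine Set.eq_singleton_iff_unique_mem.2 ⟨⟨p, trivial, hp⟩, ?_⟩
  rintro y ⟨q, -, hq⟩
  exact h q y hq

/-- A reset word of a class extends a word leading into that class to a reset word. -/
theorem sInf_resetLength_le_add {δ : Q → A → Option Q} {w u : List A} {q x : Q}
    (hne : ∃ p, stepWord δ p w = some q) (hw : ∀ p r, stepWord δ p w = some r → Insep δ q r)
    (hu : ∀ r, Insep δ q r → stepWord δ r u = some x) :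
    sInf {k : ℕ | ∃ w : List A, w.length = k ∧ (img δ Set.univ w).ncard = 1} ≤
      w.length + u.length := by
  rw [← List.length_append]
  obtain ⟨p, hp⟩ := hne
  refine sInf_resetLength_le (x := x) ⟨p, ?_⟩ fun p' y hy => ?_
  · rw [stepWord_append, hp, Option.bind_some, hu q fun _ => Iff.rfl]
  · rw [stepWord_append, Option.bind_eq_some_iff] at hy
    obtain ⟨r, hr, hry⟩ := hy
    rw [hu r (hw p' r hr), Option.some_inj] at hry
    exact hry.symm

/-- Some inseparability class has at most the average size. -/
theorem exists_small_class [Fintype Q] [Nonempty Q] (δ : Q → A → Option Q) :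
    ∃ q, {p | Insep δ q p}.ncard * Nat.card (Quotient (insepSetoid δ)) ≤ Fintype.card Q := by
  have := Fintype.ofFinite (Quotient (insepSetoid δ))
  obtain ⟨q, -, hq⟩ := Finset.exists_min_image Finset.univ
    (fun q => {p | Insep δ q p}.ncard) Finset.univ_nonempty
  refine ⟨q, ?_⟩
  have h1 := Finset.mul_card_image_le_card_of_maps_to (s := Finset.univ) (t := Finset.univ)
    (f := insepClass δ) (fun _ _ => Finset.mem_univ _) {p | Insep δ q p}.ncard fun c _ => by
      refine (hq c.out (Finset.mem_univ _)).trans_eq ?_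
      rw [← Set.ncard_coe_finset]
      congr 1
      ext p
      simp only [Set.mem_ofPred_eq, Finset.coe_filter, Finset.mem_univ, true_and]
      rw [← insepClass_eq_iff, insepClass_out]
      exact eq_comm
  rwa [Finset.card_univ, Finset.card_univ, ← Nat.card_eq_fintype_card] at h1

/-- The bound obtained by leading all states into a small class and resetting that class. -/
theorem sInf_resetLength_le_cube [Fintype Q] [Nonempty Q] (δ : Q → A → Option Q)
    (hδ : StronglyConnected δ) (h : ∃ w : List A, (img δ Set.univ w).ncard = 1) :
    ∃ k, 0 < k ∧ k * Nat.card (Quotient (insepSetoid δ)) ≤ Fintype.card Q ∧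
    sInf {k : ℕ | ∃ w : List A, w.length = k ∧ (img δ Set.univ w).ncard = 1} ≤
      Nat.card (Quotient (insepSetoid δ)) * (Nat.card (Quotient (insepSetoid δ)) - 1) / 2 +
      Fintype.card Q + Fintype.card Q * k ^ 3 := by
  obtain ⟨q₀, hq₀⟩ := exists_small_class δ
  refine ⟨_, (Set.ncard_pos (Set.toFinite {p | Insep δ q₀ p})).2
    ⟨q₀, fun _ => Iff.rfl⟩, hq₀, ?_⟩
  obtain ⟨w, hw, q, hne, hq⟩ := exists_short_to_class δ
  obtain ⟨w₀, hw₀⟩ := hδ q q₀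
  obtain ⟨v, hv, r, rfl, hr⟩ := exists_short_stepWord δ q {q₀} ⟨w₀, q₀, rfl, hw₀⟩
  obtain ⟨u, hu, x, hux⟩ := exists_reset_class_le_cube δ hδ h r
  have hle := sInf_resetLength_le_add (u := v ++ u) (x := x) hne hq fun s hs => by
    obtain ⟨t, ht, hrt⟩ := hs.exists_stepWord hr
    rw [stepWord_append, ht, Option.bind_some, hux t hrt]
  rw [List.length_append] at hle
  omega

end Threshold

/-- The numerical comparison when there are many inseparability classes of `n` states. -/
theorem classes_arith {n m k : ℕ} (hk : 0 < k) (hkm : k * m ≤ n)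
    (hm : 8 * n ^ 2 ≤ m ^ 3) :
    m * (m - 1) / 2 + n + n * k ^ 3 ≤ n * (n - 1) / 2 + 2 * n := by
  rcases Nat.lt_or_ge 1 k with h1 | h1
  · have h2 : m * 2 ≤ n := by nlinarith
    have h3 : 8 * (n * k ^ 3) ≤ n ^ 2 := by
      rcases Nat.eq_zero_or_pos n with rfl | h0
      · simp
      · refine Nat.le_of_mul_le_mul_left (c := n ^ 2) ?_ (by positivity)
        calc n ^ 2 * (8 * (n * k ^ 3)) = n * (k ^ 3 * (8 * n ^ 2)) := by ring
          _ ≤ n * (k ^ 3 * m ^ 3) := by gcongr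
          _ = n * (k * m) ^ 3 := by ring
          _ ≤ n * n ^ 3 := by gcongr
          _ = n ^ 2 * n ^ 2 := by ring
    have h4 : 4 * (m * (m - 1)) ≤ n ^ 2 := by
      calc 4 * (m * (m - 1)) ≤ 4 * (m * m) := by gcongr; omega
        _ = (m * 2) ^ 2 := by ring
        _ ≤ n ^ 2 := by gcongr
    have h5 : n * (n - 1) + n = n ^ 2 := by
      cases n with
      | zero => rfl
      | succ n => simp only [Nat.add_sub_cancel]; ring
    omega
  · obtain rfl : k = 1 := by omega
    have : m * (m - 1) / 2 ≤ n * (n - 1) / 2 :=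
      Nat.div_le_div_right (Nat.mul_le_mul (by omega) (by omega))
    omega

/-- `𝔠_P(n) ≤ 𝔠(n) + c·n^{4/3}` for some constant `c > 0`: whenever `C` is
an upper bound on the reset thresholds of all `n`-state synchronizing complete DFAs
(in particular for `C = 𝔠(n)`), every `n`-state synchronizing strongly connected partial
DFA has reset threshold at most `C + c·n^{4/3}`. -/
theorem stmt10 :
    ∃ c : ℝ, 0 < c ∧ ∀ n : ℕ, 1 ≤ n → ∀ C : ℕ,
      (∀ (Q A : Type) [Fintype Q] [Fintype A] (δc : Q → A → Q),
        Fintype.card Q = n →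
        (∃ w : List A, (imgC δc Set.univ w).ncard = 1) →
        sInf {k : ℕ | ∃ w : List A, w.length = k ∧ (imgC δc Set.univ w).ncard = 1} ≤ C) →
      ∀ (Q A : Type) [Fintype Q] [Fintype A] (δ : Q → A → Option Q),
        Fintype.card Q = n → StronglyConnected δ →
        (∃ w : List A, (img δ Set.univ w).ncard = 1) →
        ((sInf {k : ℕ | ∃ w : List A, w.length = k ∧ (img δ Set.univ w).ncard = 1} : ℕ) : ℝ)
          ≤ (C : ℝ) + c * (n : ℝ) ^ ((4 : ℝ) / 3) := by
  refine ⟨2, by norm_num, fun n hn C hC Q A _ _ δ hcard hδ h => ?_⟩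
  have hne : Nonempty Q := Fintype.card_pos_iff.1 (by omega)
  set R := sInf {k : ℕ | ∃ w : List A, w.length = k ∧ (img δ Set.univ w).ncard = 1} with hR
  set m := Nat.card (Quotient (insepSetoid δ)) with hm
  have hn1 : (1 : ℝ) ≤ n := by exact_mod_cast hn
  set t : ℝ := (n : ℝ) ^ ((1 : ℝ) / 3) with ht
  have ht1 : 1 ≤ t := Real.one_le_rpow hn1 (by norm_num)
  have ht3 : t ^ 3 = n := by
    rw [ht, ← Real.rpow_natCast, ← Real.rpow_mul (by positivity)]
    norm_num
  have ht4 : (n : ℝ) ^ ((4 : ℝ) / 3) = t ^ 4 := by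
    rw [ht, ← Real.rpow_natCast, ← Real.rpow_mul (by positivity)]
    norm_num
  rw [ht4]
  rcases Nat.lt_or_ge (m ^ 3) (8 * n ^ 2) with hlt | hge
  · obtain ⟨w, hw, q, hq, hq'⟩ := exists_short_to_class δ
    obtain ⟨u, hu, x, hux⟩ := exists_reset_class_le_of_complete hC δ hcard hδ h q
    have h1 := sInf_resetLength_le_add hq hq' hux
    rw [← hm] at hw
    rw [← hR] at h1
    have h2 : 2 * R ≤ m ^ 2 + 2 * C := by
      have : m * (m - 1) ≤ m ^ 2 := by
        rw [sq]
        exact Nat.mul_le_mul_left _ (Nat.sub_le _ _)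
      omega
    have h3 : (2 : ℝ) * R ≤ (m : ℝ) ^ 2 + 2 * C := by exact_mod_cast h2
    have h4 : (m : ℝ) ^ 3 < (2 * t ^ 2) ^ 3 := by
      have : (m : ℝ) ^ 3 < 8 * (n : ℝ) ^ 2 := by exact_mod_cast hlt
      rw [← ht3] at this
      nlinarith
    have h5 : (m : ℝ) < 2 * t ^ 2 := lt_of_pow_lt_pow_left₀ 3 (by positivity) h4
    have h6 : (m : ℝ) ^ 2 ≤ (2 * t ^ 2) ^ 2 := by gcongr
    nlinarith
  · obtain ⟨k, hk, hkm, hle⟩ := sInf_resetLength_le_cube δ hδ h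
    rw [hcard, ← hm] at hkm hle
    have h1 := classes_arith hk hkm hge
    have h2 := mul_pred_div_two_le_of_complete hn hC
    have h3 : R ≤ C + 2 * n := by omega
    have h4 : (R : ℝ) ≤ C + 2 * n := by exact_mod_cast h3
    have h5 : (n : ℝ) ≤ t ^ 4 := by
      rw [← ht3]
      exact pow_le_pow_right₀ ht1 (by norm_num)
    linarith
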